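/- Let w : (0,∞) × ℝ → ℝ be smooth, and on the domain D = {(z, R, y) ∈ ℝ³ : R > 0, R² − z² > 0} define u(z, R, y) = R^{−1/2} w( R/(R² − z²), y ). Then identically on D: −u_{zz} + u_{RR} + (1/R) u_R + (1/R²) u_{yy} = R^{−5/2} ( x² w_{xx} + w_{yy} + ¼ w ) evaluated at x = R/(R² − z²). In particular, u solves the wave equation −u_{zz} + u_{RR} + (1/R) u_R + (1/R²) u_{yy} = 0 on D if and only if w solves x² w_{xx} + w_{yy} + ¼ w = 0 on the image domain. (This is the reduction of the Laplace equation on the metric −dz² + dR² + R² dy² by the Lie point symmetry generated by the special CKV C_S = ½(z²+R²)∂_z + zR ∂_R, using the invariant coordinate x determined by z = √(R(R − x^{−1})).) -/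

import Mathlib

/-- Partial derivative `∂f/∂xⁱ` of a function `f : ℝᴺ → ℝ`. -/
noncomputable def pd {N : ℕ} (i : Fin N) (f : (Fin N → ℝ) → ℝ) : (Fin N → ℝ) → ℝ :=
  fun x => fderiv ℝ f x (Pi.single i 1)

theorem pd_eq_of_line {N : ℕ} (i : Fin N) (f : (Fin N → ℝ) → ℝ) (p : Fin N → ℝ) (c : ℝ)
    (hf : DifferentiableAt ℝ f p)
    (h : HasDerivAt (fun t => f (Function.update p i t)) c (p i)) : pd i f p = c := by
  have h1 : HasDerivAt (fun t => f (Function.update p i t))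
      (fderiv ℝ f p (Pi.single i 1)) (p i) := by
    have h2 := hasDerivAt_update p i (p i)
    have h3 : HasFDerivAt f (fderiv ℝ f p) (Function.update p i (p i)) := by
      rw [Function.update_eq_self]; exact hf.hasFDerivAt
    exact h3.comp_hasDerivAt (p i) h2
  exact h1.unique h

theorem pd_diff {N : ℕ} (i : Fin N) (f : (Fin N → ℝ) → ℝ) (p : Fin N → ℝ)
    (hf : ContDiffAt ℝ 2 f p) : DifferentiableAt ℝ (pd i f) p := by
  have h := hf.fderiv_right (m := 1) (by norm_num)
  have h2 := h.differentiableAt (by norm_num)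
  unfold pd
  exact h2.clm_apply (differentiableAt_const _)

theorem slice (s : Set ℝ) (hs : IsOpen s) (g : ℝ → ℝ) (hg : ContDiffOn ℝ 2 g s) (a : ℝ)
    (ha : a ∈ s) : HasDerivAt g (deriv g a) a ∧ HasDerivAt (deriv g) (deriv (deriv g) a) a := by
  constructor
  · exact ((hg.differentiableOn (by norm_num)).differentiableAt (hs.mem_nhds ha)).hasDerivAt
  · have h := hg.deriv_of_isOpen (m := 1) hs (by norm_num)
    exact ((h.differentiableOn (by norm_num)).differentiableAt (hs.mem_nhds ha)).hasDerivAt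

theorem hasDeriv_r (R : ℝ) (hR : 0 < R) :
    HasDerivAt (fun t : ℝ => t ^ (-(1 / 2) : ℝ)) (-(1/2) * (R ^ (-(1 / 2) : ℝ) / R)) R := by
  have h := Real.hasDerivAt_rpow_const (x := R) (p := -(1/2)) (Or.inl hR.ne')
  rwa [Real.rpow_sub_one hR.ne'] at h

theorem hasDeriv_xz (R z : ℝ) (hS : 0 < R ^ 2 - z ^ 2) :
    HasDerivAt (fun t : ℝ => R / (R ^ 2 - t ^ 2)) (2 * z * R / (R ^ 2 - z ^ 2) ^ 2) z := by
  have h := (hasDerivAt_const z R).div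
    ((hasDerivAt_const z (R ^ 2)).sub ((hasDerivAt_id z).pow 2)) hS.ne'
  refine h.congr_deriv ?_
  simp
  ring

theorem hasDeriv_xR (R z : ℝ) (hS : 0 < R ^ 2 - z ^ 2) :
    HasDerivAt (fun t : ℝ => t / (t ^ 2 - z ^ 2)) (-(R ^ 2 + z ^ 2) / (R ^ 2 - z ^ 2) ^ 2) R := by
  have h := (hasDerivAt_id R).div
    (((hasDerivAt_id R).pow 2).sub (hasDerivAt_const R (z ^ 2))) hS.ne'
  refine h.congr_deriv ?_
  simp
  ring

theorem hasDeriv_xzz (R z : ℝ) (hS : 0 < R ^ 2 - z ^ 2) :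
    HasDerivAt (fun t : ℝ => 2 * t * R / (R ^ 2 - t ^ 2) ^ 2)
      (2 * R / (R ^ 2 - z ^ 2) ^ 2 + 8 * z ^ 2 * R / (R ^ 2 - z ^ 2) ^ 3) z := by
  have h := (((hasDerivAt_id z).const_mul 2).mul_const R).div
    (((hasDerivAt_const z (R ^ 2)).sub ((hasDerivAt_id z).pow 2)).pow 2)
    (pow_ne_zero 2 hS.ne')
  refine h.congr_deriv ?_
  have := hS.ne'
  simp
  field_simp
  ring

theorem hasDeriv_xRR (R z : ℝ) (hS : 0 < R ^ 2 - z ^ 2) :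
    HasDerivAt (fun t : ℝ => -(t ^ 2 + z ^ 2) / (t ^ 2 - z ^ 2) ^ 2)
      (-2 * R / (R ^ 2 - z ^ 2) ^ 2 + 4 * R * (R ^ 2 + z ^ 2) / (R ^ 2 - z ^ 2) ^ 3) R := by
  have h := ((((hasDerivAt_id R).pow 2).add (hasDerivAt_const R (z ^ 2))).neg).div
    ((((hasDerivAt_id R).pow 2).sub (hasDerivAt_const R (z ^ 2))).pow 2)
    (pow_ne_zero 2 hS.ne')
  refine h.congr_deriv ?_
  have := hS.ne'
  simp
  field_simp
  ring

/-- Reduction of the Laplace (wave) equation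
`−u_zz + u_RR + (1/R)u_R + (1/R²)u_yy = 0` of the metric `−dz² + dR² + R²dy²`
(coordinates `0 ↦ z`, `1 ↦ R`, `2 ↦ y`) by the Lie point symmetry generated by the special
CKV `C_S`: for `w` smooth on `(0,∞) × ℝ` and `u(z,R,y) = R^{−1/2} w(R/(R²−z²), y)`, on
`D = {R > 0, R² − z² > 0}` one has identically
`−u_zz + u_RR + (1/R)u_R + (1/R²)u_yy = R^{−5/2}(x²w_xx + w_yy + ¼w)` at `x = R/(R²−z²)`;
in particular `u` solves the wave equation on `D` iff `w` solves
`x²w_xx + w_yy + ¼w = 0` on `(0,∞) × ℝ`. -/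
theorem stmt_13 (w : ℝ → ℝ → ℝ)
    (hw : ContDiffOn ℝ (⊤ : ℕ∞) (fun q : ℝ × ℝ => w q.1 q.2) (Set.Ioi 0 ×ˢ Set.univ))
    (wx wxx wy wyy : ℝ → ℝ → ℝ)
    (hwx : ∀ a b, wx a b = deriv (fun s => w s b) a)
    (hwxx : ∀ a b, wxx a b = deriv (fun s => wx s b) a)
    (hwy : ∀ a b, wy a b = deriv (fun s => w a s) b)
    (hwyy : ∀ a b, wyy a b = deriv (fun s => wy a s) b)
    (u : (Fin 3 → ℝ) → ℝ)
    (hu : ∀ p, u p = (p 1) ^ (-(1 / 2) : ℝ) *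
      w (p 1 / ((p 1) ^ 2 - (p 0) ^ 2)) (p 2)) :
    (∀ p : Fin 3 → ℝ, 0 < p 1 → 0 < (p 1) ^ 2 - (p 0) ^ 2 →
      -pd 0 (pd 0 u) p + pd 1 (pd 1 u) p + (1 / p 1) * pd 1 u p
          + (1 / (p 1) ^ 2) * pd 2 (pd 2 u) p
        = (p 1) ^ (-(5 / 2) : ℝ) *
          ((p 1 / ((p 1) ^ 2 - (p 0) ^ 2)) ^ 2
              * wxx (p 1 / ((p 1) ^ 2 - (p 0) ^ 2)) (p 2)
            + wyy (p 1 / ((p 1) ^ 2 - (p 0) ^ 2)) (p 2)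
            + (1 / 4) * w (p 1 / ((p 1) ^ 2 - (p 0) ^ 2)) (p 2)))
    ∧ ((∀ p : Fin 3 → ℝ, 0 < p 1 → 0 < (p 1) ^ 2 - (p 0) ^ 2 →
        -pd 0 (pd 0 u) p + pd 1 (pd 1 u) p + (1 / p 1) * pd 1 u p
          + (1 / (p 1) ^ 2) * pd 2 (pd 2 u) p = 0)
      ↔ (∀ a b : ℝ, 0 < a →
          a ^ 2 * wxx a b + wyy a b + (1 / 4) * w a b = 0)) := by
  have hw2 : ContDiffOn ℝ 2 (fun q : ℝ × ℝ => w q.1 q.2) (Set.Ioi 0 ×ˢ Set.univ) :=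
    hw.of_le (WithTop.coe_le_coe.mpr (le_top : (2 : ℕ∞) ≤ ⊤))
  have hopen : IsOpen (Set.Ioi (0:ℝ) ×ˢ (Set.univ : Set ℝ)) := isOpen_Ioi.prod isOpen_univ
  have sx : ∀ a b, 0 < a → HasDerivAt (fun s => w s b) (wx a b) a ∧
      HasDerivAt (fun s => wx s b) (wxx a b) a := by
    intro a b ha
    have h : ContDiffOn ℝ 2 (fun s => w s b) (Set.Ioi 0) :=
      hw2.comp (f := fun s : ℝ => (s, b)) (by fun_prop) (fun s hs => ⟨hs, trivial⟩)
    have h2 := slice _ isOpen_Ioi _ h a ha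
    have e : (fun s => wx s b) = deriv (fun s => w s b) := funext fun s => hwx s b
    rw [hwxx, hwx, e]
    exact h2
  have sy : ∀ a b, 0 < a → HasDerivAt (fun s => w a s) (wy a b) b ∧
      HasDerivAt (fun s => wy a s) (wyy a b) b := by
    intro a b ha
    have h : ContDiffOn ℝ 2 (fun s => w a s) Set.univ :=
      hw2.comp (f := fun s : ℝ => (a, s)) (by fun_prop) (fun s hs => ⟨ha, trivial⟩)
    have h2 := slice _ isOpen_univ _ h b trivial
    have e : (fun s => wy a s) = deriv (fun s => w a s) := funext fun s => hwy a s
    rw [hwyy, hwy, e]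
    exact h2
  have hu2 : ∀ p : Fin 3 → ℝ, 0 < p 1 → 0 < (p 1) ^ 2 - (p 0) ^ 2 → ContDiffAt ℝ 2 u p := by
    intro p h1 hS
    have e : u = fun p => (p 1) ^ (-(1 / 2) : ℝ) *
      w (p 1 / ((p 1) ^ 2 - (p 0) ^ 2)) (p 2) := funext hu
    rw [e]
    have c1 : ContDiffAt ℝ 2 (fun p : Fin 3 → ℝ => p 1) p := by fun_prop
    have c3 : ContDiffAt ℝ 2 (fun p : Fin 3 → ℝ => (p 1) ^ 2 - (p 0) ^ 2) p := by fun_prop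
    have c4 : ContDiffAt ℝ 2
        (fun p : Fin 3 → ℝ => (p 1 / ((p 1) ^ 2 - (p 0) ^ 2), p 2)) p :=
      (c1.div c3 hS.ne').prodMk (by fun_prop)
    have c5 : ContDiffAt ℝ 2 (fun q : ℝ × ℝ => w q.1 q.2)
        (p 1 / ((p 1) ^ 2 - (p 0) ^ 2), p 2) :=
      hw2.contDiffAt (hopen.mem_nhds ⟨div_pos h1 hS, trivial⟩)
    have c6 := c5.comp p c4
    exact (c1.rpow_const_of_ne h1.ne').mul c6
  have hu1 : ∀ p : Fin 3 → ℝ, 0 < p 1 → 0 < (p 1) ^ 2 - (p 0) ^ 2 →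
      DifferentiableAt ℝ u p := fun p h1 hS => (hu2 p h1 hS).differentiableAt (by norm_num)
  have f0 : ∀ p : Fin 3 → ℝ, 0 < p 1 → 0 < (p 1) ^ 2 - (p 0) ^ 2 →
      pd 0 u p = (p 1) ^ (-(1 / 2) : ℝ) * (wx (p 1 / ((p 1) ^ 2 - (p 0) ^ 2)) (p 2) *
        (2 * p 0 * p 1 / ((p 1) ^ 2 - (p 0) ^ 2) ^ 2)) := by
    intro p h1 hS
    apply pd_eq_of_line _ _ _ _ (hu1 p h1 hS)
    simp only [hu, Function.update_self, Function.update_of_ne (show (1 : Fin 3) ≠ 0 by decide),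
      Function.update_of_ne (show (2 : Fin 3) ≠ 0 by decide)]
    exact ((sx _ (p 2) (div_pos h1 hS)).1.comp (p 0) (hasDeriv_xz (p 1) (p 0) hS)).const_mul _
  have f1 : ∀ p : Fin 3 → ℝ, 0 < p 1 → 0 < (p 1) ^ 2 - (p 0) ^ 2 →
      pd 1 u p = -(1/2) * ((p 1) ^ (-(1 / 2) : ℝ) / p 1) *
          w (p 1 / ((p 1) ^ 2 - (p 0) ^ 2)) (p 2) +
        (p 1) ^ (-(1 / 2) : ℝ) * (wx (p 1 / ((p 1) ^ 2 - (p 0) ^ 2)) (p 2) *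
        (-((p 1) ^ 2 + (p 0) ^ 2) / ((p 1) ^ 2 - (p 0) ^ 2) ^ 2)) := by
    intro p h1 hS
    apply pd_eq_of_line _ _ _ _ (hu1 p h1 hS)
    simp only [hu, Function.update_self, Function.update_of_ne (show (0 : Fin 3) ≠ 1 by decide),
      Function.update_of_ne (show (2 : Fin 3) ≠ 1 by decide)]
    have c6 := (sx _ (p 2) (div_pos h1 hS)).1.comp (p 1) (hasDeriv_xR (p 1) (p 0) hS)
    exact (hasDeriv_r (p 1) h1).mul c6
  have f2 : ∀ p : Fin 3 → ℝ, 0 < p 1 → 0 < (p 1) ^ 2 - (p 0) ^ 2 →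
      pd 2 u p = (p 1) ^ (-(1 / 2) : ℝ) * wy (p 1 / ((p 1) ^ 2 - (p 0) ^ 2)) (p 2) := by
    intro p h1 hS
    apply pd_eq_of_line _ _ _ _ (hu1 p h1 hS)
    simp only [hu, Function.update_self, Function.update_of_ne (show (0 : Fin 3) ≠ 2 by decide),
      Function.update_of_ne (show (1 : Fin 3) ≠ 2 by decide)]
    exact (sy _ (p 2) (div_pos h1 hS)).1.const_mul _
  have hev : ∀ p : Fin 3 → ℝ, 0 < p 1 → 0 < (p 1) ^ 2 - (p 0) ^ 2 → ∀ i : Fin 3,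
      ∀ᶠ t in nhds (p i), 0 < (Function.update p i t) 1 ∧
        0 < (Function.update p i t 1) ^ 2 - (Function.update p i t 0) ^ 2 := by
    intro p h1 hS i
    have hc : Continuous (fun t : ℝ => Function.update p i t) :=
      continuous_const.update i continuous_id
    have hO : IsOpen {q : Fin 3 → ℝ | 0 < q 1 ∧ 0 < (q 1) ^ 2 - (q 0) ^ 2} :=
      by
      apply IsOpen.and
      · exact isOpen_lt (by fun_prop) (by fun_prop)
      · exact isOpen_lt (by fun_prop) (by fun_prop)
    apply hc.continuousAt.eventually_mem (hO.mem_nhds _)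
    simp only [Function.update_eq_self]
    exact ⟨h1, hS⟩
  have main : ∀ p : Fin 3 → ℝ, 0 < p 1 → 0 < (p 1) ^ 2 - (p 0) ^ 2 →
      -pd 0 (pd 0 u) p + pd 1 (pd 1 u) p + (1 / p 1) * pd 1 u p
          + (1 / (p 1) ^ 2) * pd 2 (pd 2 u) p
        = (p 1) ^ (-(5 / 2) : ℝ) *
          ((p 1 / ((p 1) ^ 2 - (p 0) ^ 2)) ^ 2
              * wxx (p 1 / ((p 1) ^ 2 - (p 0) ^ 2)) (p 2)
            + wyy (p 1 / ((p 1) ^ 2 - (p 0) ^ 2)) (p 2)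
            + (1 / 4) * w (p 1 / ((p 1) ^ 2 - (p 0) ^ 2)) (p 2)) := by
    intro p h1 hS
    have g0 := pd_eq_of_line 0 (pd 0 u) p _ (pd_diff 0 u p (hu2 p h1 hS))
      ((((((sx _ (p 2) (div_pos h1 hS)).2.comp (p 0) (hasDeriv_xz (p 1) (p 0) hS)).mul
        (hasDeriv_xzz (p 1) (p 0) hS)).const_mul ((p 1) ^ (-(1 / 2) : ℝ)))).congr_of_eventuallyEq (by
        filter_upwards [hev p h1 hS 0] with t ht
        rw [f0 _ ht.1 ht.2]
        simp))
    have g1 := pd_eq_of_line 1 (pd 1 u) p _ (pd_diff 1 u p (hu2 p h1 hS))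
      ((((((hasDeriv_r (p 1) h1).div (hasDerivAt_id (p 1)) h1.ne').const_mul (-(1/2))).mul
        ((sx _ (p 2) (div_pos h1 hS)).1.comp (p 1) (hasDeriv_xR (p 1) (p 0) hS))).add
        ((hasDeriv_r (p 1) h1).mul
        (((sx _ (p 2) (div_pos h1 hS)).2.comp (p 1) (hasDeriv_xR (p 1) (p 0) hS)).mul
        (hasDeriv_xRR (p 1) (p 0) hS)))).congr_of_eventuallyEq (by
        filter_upwards [hev p h1 hS 1] with t ht
        rw [f1 _ ht.1 ht.2]
        simp))
    have g2 := pd_eq_of_line 2 (pd 2 u) p _ (pd_diff 2 u p (hu2 p h1 hS))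
      (((sy _ (p 2) (div_pos h1 hS)).2.const_mul
        ((p 1) ^ (-(1 / 2) : ℝ))).congr_of_eventuallyEq (by
        filter_upwards [hev p h1 hS 2] with t ht
        rw [f2 _ ht.1 ht.2]
        simp))
    have hr : (p 1) ^ (-(5 / 2) : ℝ) = (p 1) ^ (-(1 / 2) : ℝ) / (p 1) ^ 2 := by
      rw [← Real.rpow_natCast, ← Real.rpow_sub h1]
      norm_num
    rw [g0, g1, g2, f1 p h1 hS, hr]
    simp only [Function.comp, id, Pi.mul_apply, Pi.div_apply]
    generalize wxx (p 1 / ((p 1) ^ 2 - (p 0) ^ 2)) (p 2) = A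
    generalize wx (p 1 / ((p 1) ^ 2 - (p 0) ^ 2)) (p 2) = B
    generalize w (p 1 / ((p 1) ^ 2 - (p 0) ^ 2)) (p 2) = C
    generalize wyy (p 1 / ((p 1) ^ 2 - (p 0) ^ 2)) (p 2) = E
    generalize (p 1) ^ (-(1 / 2) : ℝ) = r
    generalize p 0 = z at *
    generalize p 1 = R at *
    have hSn := hS.ne'
    have hRn := h1.ne'
    field_simp
    ring
  refine ⟨main, ?_, ?_⟩
  · intro h a b ha
    have hi : 0 < 1 / a := by positivity
    have h1 : 0 < (![0, 1 / a, b] : Fin 3 → ℝ) 1 := by simpa using ha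
    have hS : 0 < ((![0, 1 / a, b] : Fin 3 → ℝ) 1) ^ 2 - ((![0, 1 / a, b] : Fin 3 → ℝ) 0) ^ 2 := by
      simp; positivity
    have hm := main _ h1 hS
    rw [h _ h1 hS] at hm
    have hx : (![0, 1 / a, b] : Fin 3 → ℝ) 1 / (((![0, 1 / a, b] : Fin 3 → ℝ) 1) ^ 2
        - ((![0, 1 / a, b] : Fin 3 → ℝ) 0) ^ 2) = a := by
      simp; field_simp
    have hb : (![0, 1 / a, b] : Fin 3 → ℝ) 2 = b := rfl
    rw [hx, hb] at hm
    exact (mul_eq_zero.mp hm.symm).resolve_left (Real.rpow_pos_of_pos h1 _).ne'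
  · intro h p h1 hS
    rw [main p h1 hS, h _ _ (div_pos h1 hS), mul_zero]
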